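/- Let a ≥ 1, b ≥ 0, let L = U^a ⊕ E₈(−1)^b and M = L ⊕ U, where the last hyperbolic summand U has basis f, e with ⟨f,f⟩ = ⟨e,e⟩ = 0 and ⟨f,e⟩ = 1; write elements of M as v + m f + n e. Let Γ₃ be the subgroup of O(M) generated by: (i) φ ⊕ id_U for φ ∈ O⁺(L); (ii) the Eichler transvections t_λ for λ ∈ L, given by t_λ(v + m f + n e) = (v + mλ) + m f + (n − ⟨v,λ⟩ − m⟨λ,λ⟩/2) e; and (iii) the reflections s_δ(x) = x + ⟨x,δ⟩δ for δ ∈ R₁ = {δ ∈ M : ⟨δ,δ⟩ = −2, ⟨δ,e⟩ = 1}. Then Γ₃ acts transitively on the set {δ ∈ M : ⟨δ,δ⟩ = −2}. -/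

import Mathlib

noncomputable section

open scoped BigOperators

/-- Index type for the even unimodular lattice `L = U^a ⊕ E₈(-1)^b`. -/
abbrev LIdx (a b : ℕ) := (Fin a × Fin 2) ⊕ (Fin b × Fin 8)

/-- Elements of the lattice `L = U^a ⊕ E₈(-1)^b`. -/
abbrev LVec (a b : ℕ) := LIdx a b → ℤ

/-- The Gram matrix of `U^a ⊕ E₈(-1)^b`. -/
def gramL (a b : ℕ) : LIdx a b → LIdx a b → ℤ := fun i j =>
  match i, j with
  | Sum.inl (k, s), Sum.inl (k', s') => if k = k' ∧ s ≠ s' then 1 else 0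
  | Sum.inr (k, s), Sum.inr (k', s') => if k = k' then -(CartanMatrix.E₈ s s') else 0
  | _, _ => 0

/-- The bilinear form of `L = U^a ⊕ E₈(-1)^b`. -/
def BL (a b : ℕ) (x y : LVec a b) : ℤ :=
  ∑ i, ∑ j, x i * gramL a b i j * y j

/-- Index type for `M = L ⊕ U`; the extra hyperbolic summand has basis `f = inr 0`,
`e = inr 1`.  An element `v + m f + n e` of `M` is the function sending `inl i` to `v i`,
`inr 0` to `m` and `inr 1` to `n`. -/
abbrev MIdx (a b : ℕ) := LIdx a b ⊕ Fin 2

/-- Elements of `M = L ⊕ U`. -/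
abbrev MVec (a b : ℕ) := MIdx a b → ℤ

/-- The bilinear form of `M = L ⊕ U`: `⟨v + m f + n e, v' + m' f + n' e⟩
  = ⟨v,v'⟩_L + m n' + n m'`. -/
def BM (a b : ℕ) (x y : MVec a b) : ℤ :=
  BL a b (fun i => x (Sum.inl i)) (fun i => y (Sum.inl i)) +
    x (Sum.inr 0) * y (Sum.inr 1) + x (Sum.inr 1) * y (Sum.inr 0)

/-- The basis vector `e` of the last hyperbolic summand of `M = L ⊕ U`. -/
def eM (a b : ℕ) : MVec a b := fun i => if i = Sum.inr 1 then 1 else 0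

/-- The ℝ-bilinear extension of the form of `L = U^a ⊕ E₈(-1)^b` to `L ⊗ ℝ`. -/
def BLR (a b : ℕ) (x y : LIdx a b → ℝ) : ℝ :=
  ∑ i, ∑ j, x i * (gramL a b i j : ℝ) * y j

/-- The ℝ-linear extension of a ℤ-linear automorphism of `ι → ℤ` to `ι → ℝ`. -/
def realExt {ι : Type} [Fintype ι] [DecidableEq ι] (φ : (ι → ℤ) ≃ₗ[ℤ] (ι → ℤ)) :
    (ι → ℝ) →ₗ[ℝ] (ι → ℝ) :=
  Matrix.toLin'
    ((LinearMap.toMatrix' (φ : (ι → ℤ) →ₗ[ℤ] (ι → ℤ))).map fun z : ℤ => (z : ℝ))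

/-- `φ` preserves the orientation of maximal positive-definite subspaces of `L ⊗ ℝ`:
for some `a`-dimensional subspace `P` of `L ⊗ ℝ` on which the form is positive definite,
the composite of the real extension of `φ` restricted to `P` with the orthogonal projection
back onto `P` has positive determinant. -/
def PresOrient (a b : ℕ) (φ : LVec a b ≃ₗ[ℤ] LVec a b) : Prop :=
  ∃ P : Submodule ℝ (LIdx a b → ℝ),
    Module.finrank ℝ P = a ∧
    (∀ v ∈ P, v ≠ 0 → 0 < BLR a b v v) ∧
    ∃ proj : (LIdx a b → ℝ) →ₗ[ℝ] P,
      (∀ p : P, proj (p : LIdx a b → ℝ) = p) ∧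
      (∀ v : LIdx a b → ℝ, ∀ p ∈ P, BLR a b (v - (proj v : LIdx a b → ℝ)) p = 0) ∧
      0 < LinearMap.det (proj ∘ₗ realExt φ ∘ₗ P.subtype)

/-- The automorphisms of `M = L ⊕ U` of the form `φ ⊕ id_U` with `φ ∈ O⁺(L)`. -/
def SOplus (a b : ℕ) : Set (MVec a b ≃ₗ[ℤ] MVec a b) :=
  {σ | (∀ x s, σ x (Sum.inr s) = x (Sum.inr s)) ∧
    ∃ φ : LVec a b ≃ₗ[ℤ] LVec a b,
      (∀ u w, BL a b (φ u) (φ w) = BL a b u w) ∧ PresOrient a b φ ∧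
      ∀ x i, σ x (Sum.inl i) = φ (fun i' => x (Sum.inl i')) i}

/-- The Eichler transvections `t_λ` of `M = L ⊕ U`, for `λ ∈ L`:
`t_λ(v + m f + n e) = (v + mλ) + m f + (n - ⟨v,λ⟩ - m⟨λ,λ⟩/2) e` (stated with the last
component doubled, since `⟨λ,λ⟩` is even). -/
def STransv (a b : ℕ) : Set (MVec a b ≃ₗ[ℤ] MVec a b) :=
  {σ | ∃ lam : LVec a b, ∀ x,
    (∀ i, σ x (Sum.inl i) = x (Sum.inl i) + x (Sum.inr 0) * lam i) ∧
    σ x (Sum.inr 0) = x (Sum.inr 0) ∧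
    2 * σ x (Sum.inr 1) =
      2 * x (Sum.inr 1) - 2 * BL a b (fun i => x (Sum.inl i)) lam -
        x (Sum.inr 0) * BL a b lam lam}

/-- The reflections `s_δ : x ↦ x + ⟨x,δ⟩δ` in the elements of
`R₁ = {δ : ⟨δ,δ⟩ = -2, ⟨δ,e⟩ = 1}`. -/
def SRefl (a b : ℕ) : Set (MVec a b ≃ₗ[ℤ] MVec a b) :=
  {σ | ∃ δ : MVec a b, BM a b δ δ = -2 ∧ BM a b δ (eM a b) = 1 ∧
    ∀ x, σ x = x + BM a b x δ • δ}

/-- The subgroup `Γ₃` of `O(M)` generated by `O⁺(L) ⊕ id_U`, the Eichler transvections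
`t_λ` for `λ ∈ L`, and the reflections in the norm `-2` vectors `δ` with `⟨δ,e⟩ = 1`. -/
def Gamma3 (a b : ℕ) : Subgroup (MVec a b ≃ₗ[ℤ] MVec a b) :=
  Subgroup.closure (SOplus a b ∪ STransv a b ∪ SRefl a b)

/-! ### The form on `L` -/

lemma BL_add_left (a b : ℕ) (x y z : LVec a b) :
    BL a b (x + y) z = BL a b x z + BL a b y z := by
  simp only [BL, Pi.add_apply, add_mul, Finset.sum_add_distrib]

lemma BL_smul_left (a b : ℕ) (c : ℤ) (x z : LVec a b) :
    BL a b (c • x) z = c * BL a b x z := by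
  simp only [BL, Pi.smul_apply, smul_eq_mul, Finset.mul_sum, mul_assoc]

/-- An integral matrix whose symmetrization is the Gram matrix of `L`. -/
def halfGramL (a b : ℕ) : LIdx a b → LIdx a b → ℤ := fun i j =>
  match i, j with
  | Sum.inl (k, s), Sum.inl (k', s') => if k = k' ∧ s < s' then 1 else 0
  | Sum.inr (k, s), Sum.inr (k', s') =>
    if k = k' then (if s < s' then -(CartanMatrix.E₈ s s') else if s = s' then -1 else 0) else 0
  | _, _ => 0

lemma gramL_eq_halfGramL_add (a b : ℕ) (i j : LIdx a b) :
    gramL a b i j = halfGramL a b i j + halfGramL a b j i := by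
  have hU : ∀ s t : Fin 2, (if s ≠ t then (1 : ℤ) else 0) =
      (if s < t then 1 else 0) + (if t < s then 1 else 0) := by decide
  have hE : ∀ s t : Fin 8, -(CartanMatrix.E₈ s t) =
      (if s < t then -(CartanMatrix.E₈ s t) else if s = t then -1 else 0) +
      (if t < s then -(CartanMatrix.E₈ t s) else if t = s then -1 else 0) := by decide
  rcases i with ⟨k, s⟩ | ⟨k, s⟩ <;> rcases j with ⟨k', t⟩ | ⟨k', t⟩
  · by_cases h : k = k'
    · subst h; simpa [gramL, halfGramL] using hU s t
    · simp [gramL, halfGramL, h, Ne.symm h]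
  · rfl
  · rfl
  · by_cases h : k = k'
    · subst h; simpa [gramL, halfGramL] using hE s t
    · simp [gramL, halfGramL, h, Ne.symm h]

lemma BL_comm (a b : ℕ) (x y : LVec a b) : BL a b x y = BL a b y x := by
  unfold BL
  rw [Finset.sum_comm]
  refine Finset.sum_congr rfl fun i _ => Finset.sum_congr rfl fun j _ => ?_
  rw [gramL_eq_halfGramL_add a b i j, gramL_eq_halfGramL_add a b j i]
  ring

lemma BL_add_right (a b : ℕ) (x y z : LVec a b) :
    BL a b x (y + z) = BL a b x y + BL a b x z := by
  rw [BL_comm, BL_add_left, BL_comm a b y, BL_comm a b z]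

lemma BL_smul_right (a b : ℕ) (c : ℤ) (x z : LVec a b) :
    BL a b x (c • z) = c * BL a b x z := by
  rw [BL_comm, BL_smul_left, BL_comm]

/-- Half the norm of a vector of the even lattice `L`. -/
def halfNormL (a b : ℕ) (x : LVec a b) : ℤ :=
  ∑ i, ∑ j, x i * halfGramL a b i j * x j

lemma BL_self (a b : ℕ) (x : LVec a b) : BL a b x x = 2 * halfNormL a b x := by
  have h : BL a b x x = halfNormL a b x +
      ∑ i, ∑ j, x i * halfGramL a b j i * x j := by
    simp only [BL, halfNormL, gramL_eq_halfGramL_add, mul_add, add_mul, Finset.sum_add_distrib]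
  rw [h, Finset.sum_comm, two_mul]
  congr 1
  refine Finset.sum_congr rfl fun i _ => Finset.sum_congr rfl fun j _ => ?_
  ring

lemma gramL_eq_fromBlocks (a b : ℕ) :
    Matrix.of (gramL a b) = Matrix.fromBlocks
      (Matrix.kroneckerMap (· * ·) (1 : Matrix (Fin a) (Fin a) ℤ) !![0, 1; 1, 0]) 0 0
      (Matrix.kroneckerMap (· * ·) (1 : Matrix (Fin b) (Fin b) ℤ) (-CartanMatrix.E₈)) := by
  have hU : ∀ s t : Fin 2, (if s ≠ t then (1 : ℤ) else 0) =
      (!![0, 1; 1, 0] : Matrix (Fin 2) (Fin 2) ℤ) s t := by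
    intro s t
    fin_cases s <;> fin_cases t <;> rfl
  ext i j
  rcases i with ⟨k, s⟩ | ⟨k, s⟩ <;> rcases j with ⟨k', t⟩ | ⟨k', t⟩
  · by_cases h : k = k'
    · subst h; simpa [gramL] using hU s t
    · simp [gramL, h]
  · rfl
  · rfl
  · by_cases h : k = k'
    · subst h; simp [gramL]
    · simp [gramL, h]

lemma isUnit_det_E₈ : IsUnit (CartanMatrix.E₈).det := by
  refine Matrix.isUnit_det_of_right_inverse (B := !![
    4, 5, 7, 10, 8, 6, 4, 2;
    5, 8, 10, 15, 12, 9, 6, 3;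
    7, 10, 14, 20, 16, 12, 8, 4;
    10, 15, 20, 30, 24, 18, 12, 6;
    8, 12, 16, 24, 20, 15, 10, 5;
    6, 9, 12, 18, 15, 12, 8, 4;
    4, 6, 8, 12, 10, 8, 6, 3;
    2, 3, 4, 6, 5, 4, 3, 2]) ?_
  decide

lemma isUnit_det_gramL (a b : ℕ) : IsUnit (Matrix.of (gramL a b)).det := by
  rw [gramL_eq_fromBlocks, Matrix.det_fromBlocks_zero₂₁, Matrix.det_kronecker,
    Matrix.det_kronecker, Matrix.det_neg]
  simp [Matrix.det_fin_two, isUnit_det_E₈.pow, (isUnit_one (M := ℤ)).neg.pow]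

/-- `L` is unimodular: a vector pairing into `dℤ` with all of `L` lies in `dL`. -/
lemma exists_eq_smul_of_dvd_BL (a b : ℕ) (d : ℤ) (v : LVec a b)
    (h : ∀ w, d ∣ BL a b v w) : ∃ u, v = d • u := by
  set G := Matrix.of (gramL a b)
  have hw : ∀ j, d ∣ Matrix.vecMul v G j := fun j => by
    have := h (Pi.single j 1)
    simpa [BL, Matrix.vecMul, dotProduct, G, Pi.single_apply] using this
  choose c hc using hw
  refine ⟨Matrix.vecMul c G⁻¹, ?_⟩
  have hvG : Matrix.vecMul v G = d • c := funext hc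
  rw [← Matrix.smul_vecMul, ← hvG, Matrix.vecMul_vecMul,
    Matrix.mul_nonsing_inv _ (isUnit_det_gramL a b), Matrix.vecMul_one]

/-- `L` contains a hyperbolic pair. -/
lemma exists_hyperbolic_pair (a b : ℕ) (ha : 1 ≤ a) :
    ∃ p q : LVec a b, BL a b p p = 0 ∧ BL a b q q = 0 ∧ BL a b p q = 1 := by
  refine ⟨Pi.single (Sum.inl (⟨0, ha⟩, 0)) 1, Pi.single (Sum.inl (⟨0, ha⟩, 1)) 1, ?_, ?_, ?_⟩ <;>
    simp [BL, Pi.single_apply, gramL]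

/-! ### Elements of `Γ₃` -/

/-- The vector `v + m f + n e` of `M`. -/
def vecM {a b : ℕ} (v : LVec a b) (m n : ℤ) : MVec a b :=
  Sum.elim v ![m, n]

lemma eq_vecM {a b : ℕ} (x : MVec a b) :
    x = vecM (fun i => x (Sum.inl i)) (x (Sum.inr 0)) (x (Sum.inr 1)) := by
  ext i
  rcases i with i | i
  · rfl
  · fin_cases i <;> rfl

lemma BM_vecM {a b : ℕ} (v w : LVec a b) (m n m' n' : ℤ) :
    BM a b (vecM v m n) (vecM w m' n') = BL a b v w + m * n' + n * m' := rfl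

/-- The Eichler transvection `t_λ` as a linear map. -/
def transvMap (a b : ℕ) (lam : LVec a b) : MVec a b →ₗ[ℤ] MVec a b where
  toFun x := vecM ((fun i => x (Sum.inl i)) + x (Sum.inr 0) • lam) (x (Sum.inr 0))
    (x (Sum.inr 1) - BL a b (fun i => x (Sum.inl i)) lam - x (Sum.inr 0) * halfNormL a b lam)
  map_add' x y := by
    have h := BL_add_left a b (fun i => x (Sum.inl i)) (fun i => y (Sum.inl i)) lam
    ext i
    rcases i with i | i
    · simp [vecM]; ring
    · fin_cases i
      · simp [vecM]
      · simp only [vecM, Pi.add_apply, Sum.elim_inr, Fin.mk_one, Matrix.cons_val_one,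
          Matrix.cons_val_fin_one]
        change _ - BL a b ((fun i => x (Sum.inl i)) + (fun i => y (Sum.inl i))) lam - _ = _
        rw [h]; ring
  map_smul' c x := by
    have h := BL_smul_left a b c (fun i => x (Sum.inl i)) lam
    ext i
    rcases i with i | i
    · simp [vecM]; ring
    · fin_cases i
      · simp [vecM]
      · simp only [vecM, Pi.smul_apply, Sum.elim_inr, Fin.mk_one, Matrix.cons_val_one,
          Matrix.cons_val_fin_one, smul_eq_mul, RingHom.id_apply]
        change _ - BL a b (c • (fun i => x (Sum.inl i))) lam - _ = _
        rw [h]; ring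

lemma transvMap_vecM {a b : ℕ} (lam v : LVec a b) (m n : ℤ) :
    transvMap a b lam (vecM v m n) =
      vecM (v + m • lam) m (n - BL a b v lam - m * halfNormL a b lam) := rfl

lemma halfNormL_smul (a b : ℕ) (c : ℤ) (x : LVec a b) :
    halfNormL a b (c • x) = c ^ 2 * halfNormL a b x := by
  have h := BL_self a b (c • x)
  rw [BL_smul_left, BL_smul_right, BL_self] at h
  linarith

lemma transvMap_neg_comp (a b : ℕ) (lam : LVec a b) (x : MVec a b) :
    transvMap a b (-lam) (transvMap a b lam x) = x := by
  rw [eq_vecM x, transvMap_vecM, transvMap_vecM, ← neg_one_smul ℤ lam, halfNormL_smul,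
    BL_smul_right, BL_add_left, BL_smul_left, BL_self]
  congr 1
  · module
  · ring

/-- The Eichler transvection `t_λ` as an automorphism of `M`. -/
def transvEquiv (a b : ℕ) (lam : LVec a b) : MVec a b ≃ₗ[ℤ] MVec a b :=
  { transvMap a b lam with
    invFun := transvMap a b (-lam)
    left_inv := transvMap_neg_comp a b lam
    right_inv := fun x => by simpa using transvMap_neg_comp a b (-lam) x }

/-- Two vectors of the same norm in one `Γ₃`-orbit. -/
def GammaRel (a b : ℕ) (x y : MVec a b) : Prop :=
  (∃ γ ∈ Gamma3 a b, γ x = y) ∧ BM a b y y = BM a b x x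

lemma GammaRel.trans {a b : ℕ} {x y z : MVec a b} (h : GammaRel a b x y)
    (h' : GammaRel a b y z) : GammaRel a b x z := by
  obtain ⟨⟨γ, hγ, rfl⟩, h1⟩ := h
  obtain ⟨⟨γ', hγ', rfl⟩, h2⟩ := h'
  exact ⟨⟨γ' * γ, mul_mem hγ' hγ, rfl⟩, h2.trans h1⟩

lemma GammaRel.refl {a b : ℕ} (x : MVec a b) : GammaRel a b x x :=
  ⟨⟨1, one_mem _, rfl⟩, rfl⟩

lemma GammaRel.transv {a b : ℕ} (lam v : LVec a b) (m n : ℤ) :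
    GammaRel a b (vecM v m n)
      (vecM (v + m • lam) m (n - BL a b v lam - m * halfNormL a b lam)) := by
  refine ⟨⟨transvEquiv a b lam, Subgroup.subset_closure (Or.inl (Or.inr ⟨lam, fun x => ?_⟩)),
    transvMap_vecM lam v m n⟩, ?_⟩
  · refine ⟨fun i => rfl, rfl, ?_⟩
    change 2 * (x (Sum.inr 1) - BL a b (fun i => x (Sum.inl i)) lam -
      x (Sum.inr 0) * halfNormL a b lam) = _
    rw [BL_self]; ring
  · rw [BM_vecM, BM_vecM, BL_add_left, BL_add_right, BL_add_right, BL_smul_left, BL_smul_left,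
      BL_smul_right, BL_smul_right, BL_comm a b lam v, BL_self a b lam]
    ring

/-- The reflection in `f - e` interchanges `f` and `e`. -/
lemma GammaRel.swap {a b : ℕ} (v : LVec a b) (m n : ℤ) :
    GammaRel a b (vecM v m n) (vecM v n m) := by
  have h0 : ∀ v : LVec a b, BL a b v 0 = 0 := fun v => by simp [BL]
  refine ⟨⟨LinearEquiv.funCongrLeft ℤ ℤ (Equiv.sumCongr (Equiv.refl _) (Equiv.swap 0 1)),
    Subgroup.subset_closure (Or.inr ⟨vecM 0 1 (-1), ?_, ?_, fun x => ?_⟩), ?_⟩, ?_⟩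
  · rw [BM_vecM, h0]; norm_num
  · have he : eM a b = vecM 0 0 1 := by
      rw [eq_vecM (eM a b)]; simp [eM]; rfl
    rw [he, BM_vecM, h0]; norm_num
  · rw [eq_vecM x, BM_vecM, h0]
    ext i
    rcases i with i | i
    · simp [vecM, LinearEquiv.funCongrLeft_apply, LinearMap.funLeft_apply, Equiv.swap_apply_def]
    · fin_cases i <;> simp [vecM, LinearEquiv.funCongrLeft_apply, LinearMap.funLeft_apply]
  · ext i
    rcases i with i | i
    · simp [vecM, LinearEquiv.funCongrLeft_apply, LinearMap.funLeft_apply, Equiv.swap_apply_def]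
    · fin_cases i <;> simp [vecM, LinearEquiv.funCongrLeft_apply, LinearMap.funLeft_apply]
  · rw [BM_vecM, BM_vecM]; ring

/-- The transvections with the roles of `e` and `f` interchanged. -/
lemma GammaRel.cotransv {a b : ℕ} (lam v : LVec a b) (m n : ℤ) :
    GammaRel a b (vecM v m n)
      (vecM (v + n • lam) (m - BL a b v lam - n * halfNormL a b lam) n) :=
  ((GammaRel.swap v m n).trans (GammaRel.transv lam v n m)).trans (GammaRel.swap _ _ _)

/-! ### Reduction to a normal form -/

/-- The orbit of a norm `-2` vector contains a vector whose `f`-coefficient is nonzero. -/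
lemma GammaRel.exists_ne_zero {a b : ℕ} (x : MVec a b) (hx : BM a b x x = -2) :
    ∃ v m n, GammaRel a b x (vecM v m n) ∧ m ≠ 0 := by
  obtain ⟨v, m, n, rfl⟩ : ∃ v m n, x = vecM v m n := ⟨_, _, _, eq_vecM x⟩
  by_cases hm : m = 0
  · by_cases hn : n = 0
    · subst hm hn
      rw [BM_vecM] at hx
      refine ⟨_, _, _, (GammaRel.transv v v 0 0).trans (GammaRel.swap _ _ _), ?_⟩
      intro h
      linarith
    · exact ⟨v, n, m, GammaRel.swap v m n, hn⟩
  · exact ⟨v, m, n, GammaRel.refl _, hm⟩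

/-- If the nonzero `f`-coefficient `m` has minimal absolute value in the orbit, then it divides
the pairing of the `L`-component with every member of a hyperbolic pair. -/
lemma dvd_BL_of_minimal {a b : ℕ} {x : MVec a b} {d : ℕ}
    (hmin : ∀ v m n, GammaRel a b x (vecM v m n) → m ≠ 0 → d ≤ m.natAbs)
    {v : LVec a b} {m n : ℤ} (hx : GammaRel a b x (vecM v m n)) (hm : m ≠ 0)
    (hd : m.natAbs = d) {p q : LVec a b} (hp : BL a b p p = 0) (hpq : BL a b q p = 1) :
    m ∣ BL a b v p := by
  have hp' : halfNormL a b p = 0 := by have := BL_self a b p; omega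
  by_contra hndvd
  have hne : BL a b v p % m ≠ 0 := fun h => hndvd (Int.dvd_of_emod_eq_zero h)
  have key : m - BL a b (v + m • ((1 - BL a b v p / m) • q)) p - 0 = -(BL a b v p % m) := by
    rw [BL_add_left, BL_smul_left, BL_smul_left, hpq]
    linear_combination (Int.mul_ediv_add_emod (BL a b v p) m)
  have hrel := (hx.trans (GammaRel.transv ((1 - BL a b v p / m) • q) v m n)).trans
    (GammaRel.cotransv p _ _ _)
  rw [hp', mul_zero, key] at hrel
  have hle := hmin _ _ _ hrel (neg_ne_zero.mpr hne)
  have hnonneg := Int.emod_nonneg (BL a b v p) hm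
  have hlt := Int.emod_lt_abs (BL a b v p) hm
  rw [Int.natAbs_neg] at hle
  zify at hle hd
  rw [abs_of_nonneg hnonneg] at hle
  linarith

/-- If the nonzero `f`-coefficient `m` has minimal absolute value in the orbit, then it divides
the `e`-coefficient. -/
lemma dvd_of_minimal {a b : ℕ} (ha : 1 ≤ a) {x : MVec a b} {d : ℕ}
    (hmin : ∀ v m n, GammaRel a b x (vecM v m n) → m ≠ 0 → d ≤ m.natAbs)
    {v : LVec a b} {m n : ℤ} (hx : GammaRel a b x (vecM v m n)) (hm : m ≠ 0)
    (hd : m.natAbs = d) : m ∣ n := by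
  obtain ⟨p, q, hp, hq, hpq⟩ := exists_hyperbolic_pair a b ha
  have hqp : BL a b q p = 1 := by rw [BL_comm, hpq]
  have hp' : halfNormL a b p = 0 := by have := BL_self a b p; omega
  have hq' : halfNormL a b q = 0 := by have := BL_self a b q; omega
  obtain ⟨r, hr⟩ := dvd_BL_of_minimal hmin hx hm hd hp hqp
  obtain ⟨s, hs⟩ := dvd_BL_of_minimal hmin hx hm hd hq hpq
  have h1 := hx.trans (GammaRel.transv ((-r) • q) v m n)
  rw [halfNormL_smul, hq', BL_smul_right, hs] at h1
  have h2 := h1.trans (GammaRel.cotransv p _ _ _)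
  have hzero : BL a b (v + m • (-r) • q) p = 0 := by
    rw [BL_add_left, BL_smul_left, BL_smul_left, hqp, hr]; ring
  simp only [hp', hzero, mul_zero, sub_zero] at h2
  have h3 := dvd_BL_of_minimal hmin h2 hm hd hq hpq
  rw [BL_add_left, BL_add_left, BL_smul_left, BL_smul_left, BL_smul_left, hq, hpq, hs] at h3
  obtain ⟨t, ht⟩ := h3
  exact ⟨t - s - r * s, by linear_combination ht⟩

/-- The orbit of a norm `-2` vector contains a vector whose `f`-coefficient is `±1`. -/
lemma GammaRel.exists_isUnit {a b : ℕ} (ha : 1 ≤ a) (x : MVec a b) (hx : BM a b x x = -2) :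
    ∃ v m n, GammaRel a b x (vecM v m n) ∧ IsUnit m := by
  classical
  have hex : ∃ d : ℕ, ∃ v m n, GammaRel a b x (vecM v m n) ∧ m ≠ 0 ∧ m.natAbs = d := by
    obtain ⟨v, m, n, h, hm⟩ := GammaRel.exists_ne_zero x hx
    exact ⟨_, v, m, n, h, hm, rfl⟩
  obtain ⟨v, m, n, h, hm, hd⟩ := Nat.find_spec hex
  have hmin : ∀ v m n, GammaRel a b x (vecM v m n) → m ≠ 0 → Nat.find hex ≤ m.natAbs :=
    fun v m n h hm => Nat.find_min' hex ⟨v, m, n, h, hm, rfl⟩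
  obtain ⟨k, hk⟩ := dvd_of_minimal ha hmin h hm hd
  have hdvd : ∀ w, m ∣ BL a b v w := fun w => by
    obtain ⟨t, ht⟩ := dvd_of_minimal ha hmin (h.trans (GammaRel.transv w v m n)) hm hd
    exact ⟨k - t - halfNormL a b w, by linear_combination hk - ht⟩
  obtain ⟨u, rfl⟩ := exists_eq_smul_of_dvd_BL a b m v hdvd
  have hnorm := h.2
  rw [BM_vecM, hx, BL_smul_left, BL_smul_right, BL_self, hk] at hnorm
  refine ⟨_, m, n, h, IsUnit.of_mul_eq_one (-(m * (halfNormL a b u + k))) ?_⟩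
  linarith

/-- Every norm `-2` vector is equivalent to `f - e`. -/
lemma GammaRel.normal_form {a b : ℕ} (ha : 1 ≤ a) (x : MVec a b) (hx : BM a b x x = -2) :
    GammaRel a b x (vecM 0 1 (-1)) := by
  have hone : ∃ v n, GammaRel a b x (vecM v 1 n) := by
    obtain ⟨v, m, n, h, hm⟩ := GammaRel.exists_isUnit ha x hx
    rcases Int.isUnit_iff.mp hm with rfl | rfl
    · exact ⟨v, n, h⟩
    · obtain ⟨p, q, hp, -, hpq⟩ := exists_hyperbolic_pair a b ha
      have hp' : halfNormL a b p = 0 := by have := BL_self a b p; omega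
      have h1 := (h.trans (GammaRel.transv (v + (2 : ℤ) • q) v (-1) n)).trans
        (GammaRel.cotransv p _ _ _)
      have hv : v + (-1 : ℤ) • (v + (2 : ℤ) • q) = (-2 : ℤ) • q := by module
      rw [hp', hv, BL_smul_left, BL_comm a b q p, hpq] at h1
      norm_num at h1
      exact ⟨_, _, h1⟩
  obtain ⟨v, n, h⟩ := hone
  have h1 := h.trans (GammaRel.transv (-v) v 1 n)
  rw [one_smul, add_neg_cancel] at h1
  have hnorm := h1.2
  rw [BM_vecM, hx, show BL a b 0 0 = 0 by simp [BL]] at hnorm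
  have hn : n - BL a b v (-v) - 1 * halfNormL a b (-v) = -1 := by linarith
  rwa [hn] at h1

/-- `Γ₃` acts transitively on the set of norm `-2` vectors of `M = L ⊕ U`. -/
theorem statement11 (a b : ℕ) (ha : 1 ≤ a) (δ δ' : MVec a b)
    (hδ : BM a b δ δ = -2) (hδ' : BM a b δ' δ' = -2) :
    ∃ γ ∈ Gamma3 a b, γ δ = δ' := by
  obtain ⟨⟨γ, hγ, h⟩, -⟩ := GammaRel.normal_form ha δ hδ
  obtain ⟨⟨γ', hγ', h'⟩, -⟩ := GammaRel.normal_form ha δ' hδ'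
  refine ⟨γ'⁻¹ * γ, mul_mem (inv_mem hγ') hγ, ?_⟩
  change γ'.symm (γ δ) = δ'
  rw [h, ← h', LinearEquiv.symm_apply_apply]
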